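/- arXiv:1605.08565 — 8 statements merged into one kernel-verified Lean document; each statement's English description precedes it below -/
import Mathlib

section
/- (Appendix Theorem, n = 2, standard deviation.) Let x₁, x₂, y₁, y₂ be reals with x₂ ≤ x₁, y₂ ≤ y₁, x₁ ≤ y₁ (which holds when (x₁,x₂) is the lexicographically minimal feasible solution), and x₁ + x₂ < y₁ + y₂. Then either x₂ ≤ y₂, or SD(y₁,y₂) ≥ SD(x₁,x₂); i.e. either y is inconsistent with respect to x or y is dominated by x under the standard deviation equity measure. -/
/-- Appendix Theorem for `n = 2` with the standard deviation: if
`x₂ ≤ x₁`, `y₂ ≤ y₁`, `x₁ ≤ y₁` and `x₁ + x₂ < y₁ + y₂`, then either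
`x₂ ≤ y₂` (so `y` is inconsistent with respect to `x`) or
`SD (y₁,y₂) ≥ SD (x₁,x₂)` (so `y` is dominated by `x` under SD). -/
theorem appendix_sd (x₁ x₂ y₁ y₂ : ℝ)
    (hx : x₂ ≤ x₁) (hy : y₂ ≤ y₁) (hxy : x₁ ≤ y₁)
    (hcost : x₁ + x₂ < y₁ + y₂) :
    x₂ ≤ y₂ ∨
      Real.sqrt (((x₁ - (x₁ + x₂) / 2) ^ 2 + (x₂ - (x₁ + x₂) / 2) ^ 2) / 2) ≤
        Real.sqrt (((y₁ - (y₁ + y₂) / 2) ^ 2 + (y₂ - (y₁ + y₂) / 2) ^ 2) / 2) := by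
  refine (le_or_gt x₂ y₂).imp_right fun h => Real.sqrt_le_sqrt ?_
  have hsq : (x₁ - x₂) ^ 2 ≤ (y₁ - y₂) ^ 2 :=
    pow_le_pow_left₀ (sub_nonneg.mpr hx) (sub_le_sub hxy h.le) 2
  linarith
end

section
/- (Appendix Theorem, n = 2, Gini coefficient.) Let x₁, x₂, y₁, y₂ be reals with 0 ≤ x₂ ≤ x₁, 0 ≤ y₂ ≤ y₁, x₁ ≤ y₁ (which holds when (x₁,x₂) is the lexicographically minimal feasible solution), 0 < x₁ + x₂, and x₁ + x₂ < y₁ + y₂. Then either x₂ ≤ y₂, or G(y₁,y₂) ≥ G(x₁,x₂); i.e. either y is inconsistent with respect to x or y is dominated by x under the Gini coefficient equity measure. -/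
/-- Appendix Theorem for `n = 2` with the Gini coefficient
`G (v₁,v₂) = |v₁ − v₂| / (2 (v₁ + v₂))`: if `0 ≤ x₂ ≤ x₁`, `0 ≤ y₂ ≤ y₁`,
`x₁ ≤ y₁`, `0 < x₁ + x₂` and `x₁ + x₂ < y₁ + y₂`, then either `x₂ ≤ y₂`
(so `y` is inconsistent with respect to `x`) or `G (y₁,y₂) ≥ G (x₁,x₂)`
(so `y` is dominated by `x` under the Gini coefficient). -/
theorem appendix_gini (x₁ x₂ y₁ y₂ : ℝ)
    (hx2 : 0 ≤ x₂) (hx : x₂ ≤ x₁) (hy2 : 0 ≤ y₂) (hy : y₂ ≤ y₁) (hxy : x₁ ≤ y₁)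
    (hpos : 0 < x₁ + x₂) (hcost : x₁ + x₂ < y₁ + y₂) :
    x₂ ≤ y₂ ∨ |x₁ - x₂| / (2 * (x₁ + x₂)) ≤ |y₁ - y₂| / (2 * (y₁ + y₂)) := by
  refine or_iff_not_imp_left.mpr fun h => ?_
  have key : x₁ * y₂ ≤ y₁ * x₂ :=
    mul_le_mul hxy (not_le.mp h).le hy2 (by linarith)
  rw [abs_of_nonneg (sub_nonneg.mpr hx), abs_of_nonneg (sub_nonneg.mpr hy),
    div_le_div_iff₀ (by linarith) (by linarith)]
  linarith
end

section
/- The range equity measure satisfies the weak Pigou–Dalton transfer principle: if n ≥ 1, x : Fin n → ℝ, i ≠ j, x i ≤ x j, 0 ≤ δ ≤ x j − x i, and x' is the progressive transfer of size δ from j to i, then (max_k x' k) − (min_k x' k) ≤ (max_k x k) − (min_k x k). -/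
/-- The range equity measure satisfies the weak Pigou–Dalton transfer
principle: a progressive transfer of size `δ` from `j` to `i` does not
increase the difference between the largest and the smallest workload. -/
theorem range_weak_pigou_dalton
    (n : ℕ) (hn : 1 ≤ n) (x : Fin n → ℝ) (i j : Fin n) (hij : i ≠ j)
    (hx : x i ≤ x j) (δ : ℝ) (hδ0 : 0 ≤ δ) (hδ : δ ≤ x j - x i)
    (x' : Fin n → ℝ)
    (hx' : x' = fun k => if k = i then x i + δ else if k = j then x j - δ else x k) :
    Finset.univ.sup' ⟨i, Finset.mem_univ i⟩ x' -
        Finset.univ.inf' ⟨i, Finset.mem_univ i⟩ x' ≤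
      Finset.univ.sup' ⟨i, Finset.mem_univ i⟩ x -
        Finset.univ.inf' ⟨i, Finset.mem_univ i⟩ x := by
  have hsup (k : Fin n) : x k ≤ Finset.univ.sup' ⟨i, Finset.mem_univ i⟩ x :=
    Finset.le_sup' x (Finset.mem_univ k)
  have hinf (k : Fin n) : Finset.univ.inf' ⟨i, Finset.mem_univ i⟩ x ≤ x k :=
    Finset.inf'_le x (Finset.mem_univ k)
  subst hx'
  refine sub_le_sub (Finset.sup'_le _ _ fun k _ => ?_) (Finset.le_inf' _ _ fun k _ => ?_)
  · have hj := hsup j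
    have hk := hsup k
    split_ifs <;> linarith
  · have hi := hinf i
    have hk := hinf k
    split_ifs <;> linarith
end

section
/- The mean absolute deviation satisfies the weak Pigou–Dalton transfer principle: if n ≥ 1, x : Fin n → ℝ, i ≠ j, x i ≤ x j, 0 ≤ δ ≤ x j − x i, and x' is the progressive transfer of size δ from j to i, then (1/n) ∑ k, |x' k − m| ≤ (1/n) ∑ k, |x k − m|, where m = (1/n) ∑ k, x k is the common mean of x and x' (the transfer is mean-preserving). -/
/-- Moving two real numbers towards each other by the same amount, without overshooting, does not
increase the sum of their distances to any fixed point. -/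
theorem abs_add_sub_add_abs_sub_sub_le {a b δ : ℝ} (m : ℝ) (hδ0 : 0 ≤ δ) (hδ : δ ≤ b - a) :
    |a + δ - m| + |b - δ - m| ≤ |a - m| + |b - m| := by
  rcases abs_cases (a + δ - m) with h | h <;> rcases abs_cases (b - δ - m) with h' | h' <;>
    linarith [le_abs_self (a - m), neg_abs_le (a - m), le_abs_self (b - m), neg_abs_le (b - m)]

/-- If two functions agree away from the distinct indices `i` and `j`, their sums compare as their
partial sums over `i` and `j` do. -/
theorem Finset.sum_le_sum_of_eq_off_pair {ι : Type*} [Fintype ι] [DecidableEq ι] {f g : ι → ℝ}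
    {i j : ι} (hij : i ≠ j) (hpair : f i + f j ≤ g i + g j)
    (hoff : ∀ k, k ≠ i → k ≠ j → f k = g k) : ∑ k, f k ≤ ∑ k, g k := by
  rw [← Finset.sum_add_sum_compl {i, j} f, ← Finset.sum_add_sum_compl {i, j} g,
    Finset.sum_pair hij, Finset.sum_pair hij]
  refine add_le_add hpair (Finset.sum_congr rfl fun k hk => ?_).le
  simp only [Finset.mem_compl, Finset.mem_insert, Finset.mem_singleton, not_or] at hk
  exact hoff k hk.1 hk.2

/-- The mean absolute deviation satisfies the weak Pigou–Dalton transfer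
principle: a progressive transfer of size `δ` from `j` to `i` (which preserves
the mean `m`) does not increase the mean absolute deviation. -/
theorem mad_weak_pigou_dalton
    (n : ℕ) (hn : 1 ≤ n) (x : Fin n → ℝ) (i j : Fin n) (hij : i ≠ j)
    (hx : x i ≤ x j) (δ : ℝ) (hδ0 : 0 ≤ δ) (hδ : δ ≤ x j - x i)
    (x' : Fin n → ℝ)
    (hx' : x' = fun k => if k = i then x i + δ else if k = j then x j - δ else x k)
    (m : ℝ) (hm : m = (1 / (n : ℝ)) * ∑ k, x k) :
    (1 / (n : ℝ)) * ∑ k, |x' k - m| ≤ (1 / (n : ℝ)) * ∑ k, |x k - m| := by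
  subst hx'
  refine mul_le_mul_of_nonneg_left (Finset.sum_le_sum_of_eq_off_pair hij ?_ ?_) (by positivity)
  · simpa [hij.symm] using abs_add_sub_add_abs_sub_sub_le m hδ0 hδ
  · intro k hki hkj
    simp [hki, hkj]
end

section
/- The standard deviation satisfies the strong Pigou–Dalton transfer principle: if n ≥ 1, x : Fin n → ℝ, i ≠ j, x i ≤ x j, 0 < δ < x j − x i, and x' is the progressive transfer of size δ from j to i, then Real.sqrt((1/n) ∑ k, (x' k − m)²) < Real.sqrt((1/n) ∑ k, (x k − m)²), where m = (1/n) ∑ k, x k is the common mean of x and x'. -/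
/-- Effect of a transfer of size `δ` from `j` to `i` on the sum of squared deviations from `m`. -/
theorem sum_sq_dev_transfer {ι : Type*} [Fintype ι] [DecidableEq ι] (x : ι → ℝ) {i j : ι}
    (hij : i ≠ j) (δ m : ℝ) :
    ∑ k, ((if k = i then x i + δ else if k = j then x j - δ else x k) - m) ^ 2 =
      ∑ k, (x k - m) ^ 2 - 2 * δ * (x j - x i - δ) := by
  have h : ∀ k, ((if k = i then x i + δ else if k = j then x j - δ else x k) - m) ^ 2 =
      (x k - m) ^ 2 + (if k = i then (x i + δ - m) ^ 2 - (x i - m) ^ 2 else 0) +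
        (if k = j then (x j - δ - m) ^ 2 - (x j - m) ^ 2 else 0) := by
    intro k
    by_cases hi : k = i
    · subst hi
      simp [hij]
    · by_cases hj : k = j
      · subst hj
        simp [hi]
      · simp [hi, hj]
  simp only [h, Finset.sum_add_distrib, Finset.sum_ite_eq', Finset.mem_univ, if_true]
  ring

/-- The standard deviation satisfies the strong Pigou–Dalton transfer
principle: a strict progressive transfer of size `δ` from `j` to `i` (which
preserves the mean `m`) strictly decreases the standard deviation. -/
theorem sd_strong_pigou_dalton
    (n : ℕ) (hn : 1 ≤ n) (x : Fin n → ℝ) (i j : Fin n) (hij : i ≠ j)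
    (hx : x i ≤ x j) (δ : ℝ) (hδ0 : 0 < δ) (hδ : δ < x j - x i)
    (x' : Fin n → ℝ)
    (hx' : x' = fun k => if k = i then x i + δ else if k = j then x j - δ else x k)
    (m : ℝ) (hm : m = (1 / (n : ℝ)) * ∑ k, x k) :
    Real.sqrt ((1 / (n : ℝ)) * ∑ k, (x' k - m) ^ 2) <
      Real.sqrt ((1 / (n : ℝ)) * ∑ k, (x k - m) ^ 2) := by
  have hn' : (0 : ℝ) < n := by exact_mod_cast hn
  subst hx'
  refine Real.sqrt_lt_sqrt (by positivity) ?_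
  gcongr ?_ * ?_
  rw [sum_sq_dev_transfer x hij]
  have : 0 < 2 * δ * (x j - x i - δ) := mul_pos (by positivity) (by linarith)
  linarith
end

section
/- The Gini coefficient satisfies the strong Pigou–Dalton transfer principle: if n ≥ 1, x : Fin n → ℝ has positive mean x̄ = (1/n) ∑ k, x k > 0, i ≠ j, x i ≤ x j, 0 < δ < x j − x i, and x' is the progressive transfer of size δ from j to i, then (1/(2 n² x̄)) ∑ k, ∑ l, |x' k − x' l| < (1/(2 n² x̄)) ∑ k, ∑ l, |x k − x l| (the transfer preserves the mean, so the normalizing factor is the same for x and x'). -/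
/-- The sum of absolute differences is invariant under relabelling the entries. -/
theorem sum_abs_sub_comp_perm {ι : Type*} [Fintype ι] (σ : Equiv.Perm ι) (x : ι → ℝ) :
    ∑ k, ∑ l, |x (σ k) - x (σ l)| = ∑ k, ∑ l, |x k - x l| := by
  rw [← Equiv.sum_comp σ fun k => ∑ l, |x k - x l|]
  exact Finset.sum_congr rfl fun k _ => Equiv.sum_comp σ fun l => |x (σ k) - x l|

theorem abs_convexCombo_sub_le {t : ℝ} (ht0 : 0 ≤ t) (ht1 : t ≤ 1) (a b c d : ℝ) :
    |((1 - t) * a + t * c) - ((1 - t) * b + t * d)| ≤ (1 - t) * |a - b| + t * |c - d| := by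
  calc |((1 - t) * a + t * c) - ((1 - t) * b + t * d)|
      = |(1 - t) * (a - b) + t * (c - d)| := by ring_nf
    _ ≤ |(1 - t) * (a - b)| + |t * (c - d)| := abs_add_le _ _
    _ = (1 - t) * |a - b| + t * |c - d| := by
      rw [abs_mul, abs_mul, abs_of_nonneg (sub_nonneg.2 ht1), abs_of_nonneg ht0]

/-- Mixing a vector with a copy of itself in which two distinct entries are swapped strictly
decreases the sum of absolute differences. -/
theorem sum_abs_sub_convexCombo_swap_lt {ι : Type*} [Fintype ι] [DecidableEq ι] (x : ι → ℝ)
    {i j : ι} (hij : x i < x j) {t : ℝ} (ht0 : 0 < t) (ht1 : t < 1) :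
    ∑ k, ∑ l, |((1 - t) * x k + t * x (Equiv.swap i j k)) -
        ((1 - t) * x l + t * x (Equiv.swap i j l))| < ∑ k, ∑ l, |x k - x l| := by
  have key : ∑ k, ∑ l, ((1 - t) * |x k - x l| + t * |x (Equiv.swap i j k) - x (Equiv.swap i j l)|)
      = ∑ k, ∑ l, |x k - x l| := by
    simp_rw [Finset.sum_add_distrib, ← Finset.mul_sum]
    rw [sum_abs_sub_comp_perm]
    ring
  rw [← key]
  have hle := fun k l => abs_convexCombo_sub_le ht0.le ht1.le (x k) (x l)
    (x (Equiv.swap i j k)) (x (Equiv.swap i j l))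
  refine Finset.sum_lt_sum (fun k _ => Finset.sum_le_sum fun l _ => hle k l)
    ⟨i, Finset.mem_univ i, Finset.sum_lt_sum (fun l _ => hle i l) ⟨j, Finset.mem_univ j, ?_⟩⟩
  rw [Equiv.swap_apply_left, Equiv.swap_apply_right, abs_of_neg (sub_neg.2 hij),
    abs_of_pos (sub_pos.2 hij), abs_lt]
  constructor <;> nlinarith [mul_pos ht0 (sub_pos.2 hij),
    mul_pos (sub_pos.2 ht1) (sub_pos.2 hij)]

/-- The Gini coefficient satisfies the strong Pigou–Dalton transfer principle:
for a vector with positive mean `m`, a strict progressive transfer of size `δ`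
from `j` to `i` (which preserves the mean) strictly decreases the Gini
coefficient. -/
theorem gini_strong_pigou_dalton
    (n : ℕ) (hn : 1 ≤ n) (x : Fin n → ℝ)
    (m : ℝ) (hm : m = (1 / (n : ℝ)) * ∑ k, x k) (hmpos : 0 < m)
    (i j : Fin n) (hij : i ≠ j)
    (hx : x i ≤ x j) (δ : ℝ) (hδ0 : 0 < δ) (hδ : δ < x j - x i)
    (x' : Fin n → ℝ)
    (hx' : x' = fun k => if k = i then x i + δ else if k = j then x j - δ else x k) :
    (1 / (2 * (n : ℝ) ^ 2 * m)) * ∑ k, ∑ l, |x' k - x' l| <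
      (1 / (2 * (n : ℝ) ^ 2 * m)) * ∑ k, ∑ l, |x k - x l| := by
  have hd : 0 < x j - x i := hδ0.trans hδ
  have hmix : x' = fun k => (1 - δ / (x j - x i)) * x k +
      δ / (x j - x i) * x (Equiv.swap i j k) := by
    rw [hx']
    funext k
    rcases eq_or_ne k i with rfl | hki
    · rw [if_pos rfl, Equiv.swap_apply_left]
      field_simp
      ring
    rcases eq_or_ne k j with rfl | hkj
    · rw [if_neg hki, if_pos rfl, Equiv.swap_apply_right]
      field_simp
      ring
    · rw [if_neg hki, if_neg hkj, Equiv.swap_apply_of_ne_of_ne hki hkj]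
      ring
  have hn0 : (0 : ℝ) < n := by exact_mod_cast hn
  refine mul_lt_mul_of_pos_left ?_ (by positivity)
  rw [hmix]
  exact sum_abs_sub_convexCombo_swap_lt x (sub_pos.1 hd) (div_pos hδ0 hd) ((div_lt_one hd).2 hδ)
end

section
/- (Strong monotonicity of the lexicographic min-max measure, Table 2.) Let x, y : Fin n → ℝ with x i ≤ y i for all i and x j < y j for some j, and let x↓ and y↓ be non-increasing rearrangements of x and y respectively. Then x↓ is strictly lexicographically smaller than y↓: there exists k : Fin n such that x↓ m = y↓ m for all m < k and x↓ k < y↓ k. -/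
/-- Non-increasing rearrangement is monotone: pointwise domination is inherited by the
sorted vectors. -/
theorem antitone_rearrangement_le {α : Type*} [LinearOrder α] {n : ℕ} {x y : Fin n → α}
    (hle : ∀ i, x i ≤ y i) {σ τ : Equiv.Perm (Fin n)}
    (hσ : Antitone (x ∘ σ)) (hτ : Antitone (y ∘ τ)) (k : Fin n) :
    (x ∘ σ) k ≤ (y ∘ τ) k := by
  by_contra! hk
  have hmaps : ∀ m ∈ Finset.Iic k, (σ.trans τ.symm) m ∈ Finset.Iio k := by
    intro m hm
    rw [Finset.mem_Iic] at hm
    rw [Finset.mem_Iio]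
    by_contra! hkm
    have hy : y (σ m) ≤ (y ∘ τ) k := by simpa using hτ hkm
    exact (hk.trans_le ((hσ hm).trans (hle (σ m)))).not_ge hy
  have hcard := Finset.card_le_card_of_injOn _ hmaps (σ.trans τ.symm).injective.injOn
  simp at hcard


/-- Strong monotonicity of the lexicographic min-max measure: if `x i ≤ y i`
for all `i` with at least one strict inequality, and `x ∘ σ`, `y ∘ τ` are
non-increasing rearrangements of `x`, `y`, then `x ∘ σ` is strictly
lexicographically smaller than `y ∘ τ`. -/
theorem lex_minmax_strong_monotone
    (n : ℕ) (x y : Fin n → ℝ)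
    (hle : ∀ i, x i ≤ y i) (hlt : ∃ j, x j < y j)
    (σ τ : Equiv.Perm (Fin n))
    (hσ : Antitone (x ∘ σ)) (hτ : Antitone (y ∘ τ)) :
    ∃ k : Fin n, (∀ m < k, (x ∘ σ) m = (y ∘ τ) m) ∧ (x ∘ σ) k < (y ∘ τ) k := by
  have hpt := antitone_rearrangement_le hle hσ hτ
  have hex : ∃ k, (x ∘ σ) k < (y ∘ τ) k := by
    by_contra! hge
    obtain ⟨j, hj⟩ := hlt
    have hsum : ∑ i, x i < ∑ i, y i :=
      Finset.sum_lt_sum (fun i _ => hle i) ⟨j, Finset.mem_univ j, hj⟩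
    rw [← Equiv.sum_comp σ x, ← Equiv.sum_comp τ y] at hsum
    exact hsum.not_ge (Finset.sum_le_sum fun i _ => hge i)
  obtain ⟨k, hk, hmin⟩ := WellFounded.has_min wellFounded_lt {k | (x ∘ σ) k < (y ∘ τ) k} hex
  exact ⟨k, fun m hm => (hpt m).eq_of_not_lt fun h => hmin m h hm, hk⟩
end

section
/- (Strong Pigou–Dalton principle for the lexicographic min-max measure, Table 2.) Let x : Fin n → ℝ, let i ≠ j with x i < x j, let 0 < δ < x j − x i, and let x' be the strict progressive transfer of size δ from j to i (x' i = x i + δ, x' j = x j − δ, x' k = x k otherwise). Then the non-increasing rearrangement x'↓ of x' is strictly lexicographically smaller than the non-increasing rearrangement x↓ of x: there exists k : Fin n with x'↓ m = x↓ m for all m < k and x'↓ k < x↓ k. -/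
/-- The `m`-th entry of a non-increasing rearrangement of `x` is at least `t` exactly when more than
`m` entries of `x` are at least `t`. -/
lemma le_antitone_comp_perm_iff_lt_card {n : ℕ} {x : Fin n → ℝ} {τ : Equiv.Perm (Fin n)}
    (hτ : Antitone (x ∘ τ)) (t : ℝ) (m : Fin n) :
    t ≤ (x ∘ τ) m ↔ (m : ℕ) < (Finset.univ.filter fun k => t ≤ x k).card := by
  have hcard : (Finset.univ.filter fun k => t ≤ x k).card =
      (Finset.univ.filter fun k => t ≤ (x ∘ τ) k).card := by
    symm
    apply Finset.card_equiv τ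
    simp
  rw [hcard]
  exact (Tuple.lt_card_ge_iff_apply_ge_of_antitone hτ).symm

/-- If two vectors have equally many entries above every `z > y`, but the first has fewer entries
that are at least `y`, then its non-increasing rearrangement is strictly lexicographically
smaller. -/
lemma antitone_comp_perm_lex_lt_of_card {n : ℕ} {u v : Fin n → ℝ} {σ τ : Equiv.Perm (Fin n)}
    (hσ : Antitone (u ∘ σ)) (hτ : Antitone (v ∘ τ)) (y : ℝ)
    (heq : ∀ z, y < z → (Finset.univ.filter fun k => z ≤ u k).card =
      (Finset.univ.filter fun k => z ≤ v k).card)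
    (hlt : (Finset.univ.filter fun k => y ≤ u k).card <
      (Finset.univ.filter fun k => y ≤ v k).card) :
    ∃ k : Fin n, (∀ m < k, (u ∘ σ) m = (v ∘ τ) m) ∧ (u ∘ σ) k < (v ∘ τ) k := by
  have hiff : ∀ z, y < z → ∀ m, z ≤ (u ∘ σ) m ↔ z ≤ (v ∘ τ) m := fun z hz m => by
    rw [le_antitone_comp_perm_iff_lt_card hσ, le_antitone_comp_perm_iff_lt_card hτ, heq z hz]
  have hn : (Finset.univ.filter fun k => y ≤ v k).card ≤ n := by
    simpa using Finset.card_le_univ (Finset.univ.filter fun k => y ≤ v k)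
  refine ⟨⟨_, hlt.trans_le hn⟩, fun m hm => ?_, ?_⟩
  · have hu : y ≤ (u ∘ σ) m := (le_antitone_comp_perm_iff_lt_card hσ y m).2 hm
    have hv : y ≤ (v ∘ τ) m :=
      (le_antitone_comp_perm_iff_lt_card hτ y m).2 (lt_trans (Fin.lt_def.1 hm) hlt)
    rcases lt_trichotomy ((u ∘ σ) m) ((v ∘ τ) m) with h | h | h
    · exact absurd ((hiff _ (hu.trans_lt h) m).2 le_rfl) h.not_ge
    · exact h
    · exact absurd ((hiff _ (hv.trans_lt h) m).1 le_rfl) h.not_ge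
  · refine lt_of_lt_of_le (b := y) ?_ ((le_antitone_comp_perm_iff_lt_card hτ y _).2 hlt)
    rw [← not_le, le_antitone_comp_perm_iff_lt_card hσ]
    exact lt_irrefl _


/-- Strong Pigou–Dalton principle for the lexicographic min-max measure: a
strict progressive transfer of size `δ` from `j` to `i` makes the
non-increasing rearrangement of the new vector `x'` strictly lexicographically
smaller than the non-increasing rearrangement of `x`. -/
theorem lex_minmax_strong_pigou_dalton
    (n : ℕ) (x : Fin n → ℝ) (i j : Fin n) (hij : i ≠ j)
    (hx : x i < x j) (δ : ℝ) (hδ0 : 0 < δ) (hδ : δ < x j - x i)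
    (x' : Fin n → ℝ)
    (hx' : x' = fun k => if k = i then x i + δ else if k = j then x j - δ else x k)
    (σ τ : Equiv.Perm (Fin n))
    (hσ : Antitone (x' ∘ σ)) (hτ : Antitone (x ∘ τ)) :
    ∃ k : Fin n, (∀ m < k, (x' ∘ σ) m = (x ∘ τ) m) ∧ (x' ∘ σ) k < (x ∘ τ) k := by
  refine antitone_comp_perm_lex_lt_of_card hσ hτ (x j) (fun z hz => ?_) (Finset.card_lt_card ?_)
  · congr 1
    ext k
    simp only [Finset.mem_filter, Finset.mem_univ, true_and, hx']
    split_ifs with hi hj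
    · subst hi
      exact iff_of_false (by linarith) (by linarith)
    · subst hj
      exact iff_of_false (by linarith) (by linarith)
    · rfl
  · rw [Finset.ssubset_iff_of_subset]
    · refine ⟨j, by simp, ?_⟩
      simp [hx', hij.symm, hδ0]
    · intro k
      simp only [Finset.mem_filter, Finset.mem_univ, true_and, hx']
      split_ifs with hi hj
      · intro h
        linarith
      · intro h
        linarith
      · exact id
end
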